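/- arXiv:2210.09649 — 4 statements merged into one kernel-verified Lean document; each statement's English description precedes it below -/
import Mathlib

section
/- Let d ≥ 1, let λ ∈ [0,1], and let g ∈ L¹(ℝ^d) be a nonnegative radial decreasing function (i.e., g(x) = h(‖x‖) for some nonincreasing h : [0,∞) → [0,∞)). Then for every t > 0, the Lebesgue measure of the set {x ∈ ℝ^d : M_λ g(x) > t} is at most ((1+λ)^d / t) · ‖g‖₁. -/
open MeasureTheory Metric
open scoped ENNReal

/-- The almost uncentered maximal function `M_λ g` on `ℝ^d`:
supremum of averages of `g` over closed balls `B(y,ρ)` with `‖x - y‖ ≤ λ ρ`. -/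
noncomputable def almostMaximal (d : ℕ) (lam : ℝ)
    (g : EuclideanSpace ℝ (Fin d) → ℝ) (x : EuclideanSpace ℝ (Fin d)) : ℝ≥0∞ :=
  ⨆ (y : EuclideanSpace ℝ (Fin d)) (ρ : ℝ) (_ : 0 < ρ) (_ : ‖x - y‖ ≤ lam * ρ),
    (∫⁻ z in closedBall y ρ, ENNReal.ofReal (g z)) / volume (closedBall y ρ)


lemma vol_cb (d : ℕ) (x : EuclideanSpace ℝ (Fin d)) (r : ℝ) (hr : 0 ≤ r) :
    volume (closedBall x r) =
      ENNReal.ofReal (r ^ d) * volume (ball (0 : EuclideanSpace ℝ (Fin d)) 1) := by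
  have := Measure.addHaar_closedBall (volume : Measure (EuclideanSpace ℝ (Fin d))) x hr
  simpa using this

lemma lens_subset {d : ℕ} (y z : EuclideanSpace ℝ (Fin d)) (a ρ : ℝ) (ha : 0 ≤ a)
    (hρ : 0 ≤ ρ) (hy : 0 < ‖y‖) (hay : a ≤ ‖y‖) (hz : ‖z‖ ≤ a) (hzy : ‖z - y‖ ≤ ρ) :
    ‖z - (a ^ 2 / ‖y‖ ^ 2) • y‖ ≤ a * ρ / ‖y‖ := by
  set s := a ^ 2 / ‖y‖ ^ 2 with hs
  have hsr : s * ‖y‖ ^ 2 = a ^ 2 := by rw [hs]; field_simp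
  have hs0 : 0 ≤ s := by positivity
  have hs1 : s ≤ 1 := by
    rw [hs, div_le_one (by positivity)]
    gcongr
  have e1 : ‖z - s • y‖ ^ 2 = (1 - s) * ‖z‖ ^ 2 + s * ‖z - y‖ ^ 2 - s * (1 - s) * ‖y‖ ^ 2 := by
    rw [@norm_sub_sq_real, @norm_sub_sq_real, inner_smul_right, norm_smul, Real.norm_of_nonneg hs0]
    ring
  have h1 : ‖z‖ ^ 2 ≤ a ^ 2 := by gcongr
  have h2 : ‖z - y‖ ^ 2 ≤ ρ ^ 2 := by gcongr
  apply le_of_pow_le_pow_left₀ two_ne_zero (by positivity)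
  have e2 : (a * ρ / ‖y‖) ^ 2 = s * ρ ^ 2 := by rw [hs]; field_simp
  rw [e1, e2]
  nlinarith [mul_le_mul_of_nonneg_left h1 (sub_nonneg.2 hs1), mul_le_mul_of_nonneg_left h2 hs0]

lemma level_bound {d : ℕ} (L : Set (EuclideanSpace ℝ (Fin d)))
    (hL : ∀ z ∈ L, ∀ w, ‖w‖ ≤ ‖z‖ → w ∈ L) (y : EuclideanSpace ℝ (Fin d)) (hy : 0 < ‖y‖)
    (ρ : ℝ) (hρ : 0 ≤ ρ) :
    volume (L ∩ closedBall y ρ) * ENNReal.ofReal (‖y‖ ^ d)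
      ≤ volume L * ENNReal.ofReal (ρ ^ d) := by
  by_cases hc : ∃ z ∈ L, ‖y‖ ≤ ‖z‖
  · obtain ⟨z, hz, hyz⟩ := hc
    have h1 : volume (closedBall (0 : EuclideanSpace ℝ (Fin d)) ‖y‖) ≤ volume L := by
      apply measure_mono
      intro w hw
      exact hL z hz w ((mem_closedBall_zero_iff.1 hw).trans hyz)
    have h2 : volume (L ∩ closedBall y ρ) ≤ volume (closedBall y ρ) :=
      measure_mono Set.inter_subset_right
    rw [vol_cb _ _ _ hy.le] at h1
    rw [vol_cb _ _ _ hρ] at h2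
    calc _ ≤ _ := mul_le_mul_left h2 _
      _ = (ENNReal.ofReal (‖y‖ ^ d) * volume (ball (0 : EuclideanSpace ℝ (Fin d)) 1)) * ENNReal.ofReal (ρ ^ d) := by ring
      _ ≤ _ := mul_le_mul_left h1 _
  · push Not at hc
    rcases L.eq_empty_or_nonempty with rfl | ⟨z0, hz0⟩
    · simp
    have hbdd : BddAbove (norm '' L) := ⟨‖y‖, by rintro _ ⟨z, hz, rfl⟩; exact (hc z hz).le⟩
    set a := sSup (norm '' L) with ha
    have hle : ∀ z ∈ L, ‖z‖ ≤ a := fun z hz => le_csSup hbdd ⟨z, hz, rfl⟩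
    have ha0 : 0 ≤ a := (norm_nonneg z0).trans (hle z0 hz0)
    have hay : a ≤ ‖y‖ := csSup_le ⟨_, z0, hz0, rfl⟩
      (by rintro _ ⟨z, hz, rfl⟩; exact (hc z hz).le)
    have h1 : volume (ball (0 : EuclideanSpace ℝ (Fin d)) a) ≤ volume L := by
      apply measure_mono
      intro w hw
      obtain ⟨_, ⟨z, hz, rfl⟩, hwz⟩ := exists_lt_of_lt_csSup (s := norm '' L) ⟨_, z0, hz0, rfl⟩
        (mem_ball_zero_iff.1 hw)
      exact hL z hz w hwz.le
    have hcb : volume (closedBall (0 : EuclideanSpace ℝ (Fin d)) a) ≤ volume L := by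
      by_cases haa : a = 0
      · apply measure_mono
        intro w hw
        apply hL z0 hz0
        rw [haa] at hw
        have := mem_closedBall_zero_iff.1 hw
        exact this.trans (norm_nonneg _)
      · rw [Measure.addHaar_ball_of_pos _ _ (lt_of_le_of_ne ha0 (Ne.symm haa)), finrank_euclideanSpace_fin] at h1
        rwa [vol_cb _ _ _ ha0]
    have h2 : volume (L ∩ closedBall y ρ) ≤
        volume (closedBall ((a ^ 2 / ‖y‖ ^ 2) • y) (a * ρ / ‖y‖)) := by
      apply measure_mono
      rintro z ⟨hz, hzy⟩
      rw [mem_closedBall, dist_eq_norm] at hzy ⊢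
      exact lens_subset y z a ρ ha0 hρ hy hay (hle z hz) hzy
    rw [vol_cb _ _ _ (by positivity)] at h2
    rw [vol_cb _ _ _ ha0] at hcb
    calc _ ≤ _ := mul_le_mul_left h2 _
      _ = (ENNReal.ofReal ((a * ρ / ‖y‖) ^ d) * ENNReal.ofReal (‖y‖ ^ d)) * volume (ball (0 : EuclideanSpace ℝ (Fin d)) 1) := by ring
      _ = (ENNReal.ofReal (a ^ d) * ENNReal.ofReal (ρ ^ d)) * volume (ball (0 : EuclideanSpace ℝ (Fin d)) 1) := by
        rw [← ENNReal.ofReal_mul (by positivity), ← ENNReal.ofReal_mul (by positivity),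
          ← mul_pow, ← mul_pow, div_mul_cancel₀ _ hy.ne']
      _ = (ENNReal.ofReal (a ^ d) * volume (ball (0 : EuclideanSpace ℝ (Fin d)) 1)) * ENNReal.ofReal (ρ ^ d) := by ring
      _ ≤ _ := mul_le_mul_left hcb _

lemma int_bound {d : ℕ} (g : EuclideanSpace ℝ (Fin d) → ℝ) (hg : Integrable g)
    (h0 : ∀ x, 0 ≤ g x) (hm : ∀ z w, ‖w‖ ≤ ‖z‖ → g z ≤ g w)
    (y : EuclideanSpace ℝ (Fin d)) (hy : 0 < ‖y‖) (ρ : ℝ) (hρ : 0 ≤ ρ) :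
    (∫⁻ z in closedBall y ρ, ENNReal.ofReal (g z)) * ENNReal.ofReal (‖y‖ ^ d)
      ≤ (∫⁻ z, ENNReal.ofReal (g z)) * ENNReal.ofReal (ρ ^ d) := by
  rw [lintegral_eq_lintegral_meas_lt _ (Filter.Eventually.of_forall h0) hg.aemeasurable,
    lintegral_eq_lintegral_meas_lt _ (Filter.Eventually.of_forall h0) hg.aemeasurable.restrict,
    ← lintegral_mul_const' _ _ ENNReal.ofReal_ne_top,
    ← lintegral_mul_const' _ _ ENNReal.ofReal_ne_top]
  apply lintegral_mono
  intro s
  dsimp only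
  rw [Measure.restrict_apply' measurableSet_closedBall]
  exact level_bound _ (fun z hz w hw => lt_of_lt_of_le hz (hm z w hw)) y hy ρ hρ

theorem weak_type_one_one_radial_decreasing
    (d : ℕ) (hd : 1 ≤ d) (lam : ℝ) (hlam : lam ∈ Set.Icc (0 : ℝ) 1)
    (g : EuclideanSpace ℝ (Fin d) → ℝ) (hg : Integrable g)
    (h : ℝ → ℝ) (hpos : ∀ r : ℝ, 0 ≤ r → 0 ≤ h r)
    (hmono : AntitoneOn h (Set.Ici (0 : ℝ)))
    (hrad : ∀ x : EuclideanSpace ℝ (Fin d), g x = h ‖x‖) :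
    ∀ t : ℝ, 0 < t →
      volume {x : EuclideanSpace ℝ (Fin d) | ENNReal.ofReal t < almostMaximal d lam g x}
        ≤ ENNReal.ofReal ((1 + lam) ^ d / t * ∫ x, g x) := by
  
  intro t ht
  obtain ⟨hl0, hl1⟩ := hlam
  have h0 : ∀ x, 0 ≤ g x := fun x => by rw [hrad]; exact hpos _ (norm_nonneg _)
  have hm : ∀ z w, ‖w‖ ≤ ‖z‖ → g z ≤ g w := fun z w hw => by
    rw [hrad, hrad]; exact hmono (norm_nonneg _) (norm_nonneg _) hw
  set N := ∫ x, g x with hN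
  have hN0 : 0 ≤ N := integral_nonneg h0
  have hNl : ∫⁻ z, ENNReal.ofReal (g z) = ENNReal.ofReal N :=
    (ofReal_integral_eq_lintegral_ofReal hg (Filter.Eventually.of_forall h0)).symm
  set ω := (volume (ball (0 : EuclideanSpace ℝ (Fin d)) 1)).toReal with hω
  have hωt : volume (ball (0 : EuclideanSpace ℝ (Fin d)) 1) ≠ ⊤ := measure_ball_lt_top.ne
  have hω0 : 0 < ω := ENNReal.toReal_pos (measure_ball_pos _ _ one_pos).ne' hωt
  have hωe : volume (ball (0 : EuclideanSpace ℝ (Fin d)) 1) = ENNReal.ofReal ω :=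
    (ENNReal.ofReal_toReal hωt).symm
  have key : ∀ x, ENNReal.ofReal t < almostMaximal d lam g x →
      t * ω * ‖x‖ ^ d ≤ (1 + lam) ^ d * N := by
    intro x hx
    unfold almostMaximal at hx
    simp only [lt_iSup_iff] at hx
    obtain ⟨y, ρ, hρ, hxy, hx⟩ := hx
    have hv : volume (closedBall y ρ) = ENNReal.ofReal (ρ ^ d * ω) := by
      rw [vol_cb _ _ _ hρ.le, hωe, ENNReal.ofReal_mul (by positivity)]
    have hA : ENNReal.ofReal (t * (ρ ^ d * ω)) ≤
        ∫⁻ z in closedBall y ρ, ENNReal.ofReal (g z) := by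
      rw [ENNReal.ofReal_mul ht.le, ← hv]
      exact ENNReal.mul_le_of_le_div hx.le
    have hA1 : t * (ρ ^ d * ω) ≤ N := by
      rw [← ENNReal.ofReal_le_ofReal_iff hN0, ← hNl]
      exact hA.trans (setLIntegral_le_lintegral _ _)
    have hA2 : t * (‖y‖ ^ d * ω) ≤ N := by
      rcases (norm_nonneg y).eq_or_lt with hy | hy
      · rw [← hy, zero_pow (by omega)]; simpa using hN0
      · have := (mul_le_mul_left hA _).trans (int_bound g hg h0 hm y hy ρ hρ.le)
        rw [hNl, ← ENNReal.ofReal_mul (by positivity), ← ENNReal.ofReal_mul hN0,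
          ENNReal.ofReal_le_ofReal_iff (by positivity)] at this
        have hp : 0 < ρ ^ d := by positivity
        refine le_of_mul_le_mul_right ?_ hp
        linarith
    have hM : t * ((max ρ ‖y‖) ^ d * ω) ≤ N := by
      rcases max_choice ρ ‖y‖ with e | e <;> rw [e] <;> assumption
    have hxn : ‖x‖ ≤ (1 + lam) * max ρ ‖y‖ := by
      have e1 : ‖x‖ ≤ ‖x - y‖ + ‖y‖ := by simpa using norm_add_le (x - y) y
      have e2 := le_max_right ρ ‖y‖
      have e3 := mul_le_mul_of_nonneg_left (le_max_left ρ ‖y‖) hl0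
      linarith
    calc t * ω * ‖x‖ ^ d ≤ t * ω * ((1 + lam) * max ρ ‖y‖) ^ d := by gcongr
      _ = (1 + lam) ^ d * (t * ((max ρ ‖y‖) ^ d * ω)) := by rw [mul_pow]; ring
      _ ≤ _ := by gcongr
  set R := ((1 + lam) ^ d * N / (t * ω)) ^ ((d : ℝ)⁻¹) with hR
  have hR0 : 0 ≤ R := by positivity
  have hRd : R ^ d = (1 + lam) ^ d * N / (t * ω) :=
    Real.rpow_inv_natCast_pow (by positivity) (by omega)
  calc _ ≤ volume (closedBall (0 : EuclideanSpace ℝ (Fin d)) R) := by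
        apply measure_mono
        intro x hx
        rw [mem_closedBall_zero_iff]
        apply le_of_pow_le_pow_left₀ (n := d) (by omega) hR0
        rw [hRd, le_div_iff₀ (by positivity)]
        linarith [key x hx]
    _ = _ := by
        rw [vol_cb _ _ _ hR0, hωe, ← ENNReal.ofReal_mul (by positivity), hRd]
        congr 1
        field_simp
end

section
/- Let d ≥ 1 and λ ∈ [0,1]. The constant (1+λ)^d in the weak type (1,1) inequality for M_λ on radial decreasing functions is sharp: for every c < (1+λ)^d there exist a nonnegative radial decreasing function g ∈ L¹(ℝ^d) with ‖g‖₁ > 0 and a t > 0 such that the Lebesgue measure of {x ∈ ℝ^d : M_λ g(x) > t} is strictly greater than (c/t)·‖g‖₁. -/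
open MeasureTheory Metric
open scoped ENNReal

theorem aux_exists_r (d : ℕ) (lam c : ℝ) (hc : c < (1 + lam) ^ d) :
    ∃ r : ℝ, 0 < r ∧ r < 1 ∧ c < (1 - r) * (1 + lam - r) ^ d := by
  have hcont : Continuous (fun r : ℝ => (1 - r) * (1 + lam - r) ^ d) := by fun_prop
  have h0 : c < (fun r : ℝ => (1 - r) * (1 + lam - r) ^ d) 0 := by simpa using hc
  have h1 := (hcont.tendsto 0).eventually (lt_mem_nhds h0)
  have h2 : ∀ᶠ r in nhds (0:ℝ), r < 1 := gt_mem_nhds (by norm_num)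
  have h3 := ((h1.and h2).filter_mono nhdsWithin_le_nhds).and
    (self_mem_nhdsWithin : Set.Ioi (0:ℝ) ∈ nhdsWithin 0 (Set.Ioi 0))
  obtain ⟨r, ⟨h4, h5⟩, h6⟩ := h3.exists
  exact ⟨r, h6, h5, h4⟩

theorem sharpness_weak_type_constant
    (d : ℕ) (hd : 1 ≤ d) (lam : ℝ) (hlam : lam ∈ Set.Icc (0 : ℝ) 1)
    (c : ℝ) (hc : c < (1 + lam) ^ d) :
    ∃ (g : EuclideanSpace ℝ (Fin d) → ℝ) (h : ℝ → ℝ) (t : ℝ),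
      Integrable g ∧
      (∀ r : ℝ, 0 ≤ r → 0 ≤ h r) ∧
      AntitoneOn h (Set.Ici (0 : ℝ)) ∧
      (∀ x : EuclideanSpace ℝ (Fin d), g x = h ‖x‖) ∧
      0 < ∫ x, g x ∧
      0 < t ∧
      ENNReal.ofReal (c / t * ∫ x, g x)
        < volume {x : EuclideanSpace ℝ (Fin d) | ENNReal.ofReal t < almostMaximal d lam g x} := by
  obtain ⟨r, hr0, hr1, hr⟩ := aux_exists_r d lam c hc
  obtain ⟨hl0, hl1⟩ := hlam
  set v : ℝ := (volume (ball (0 : EuclideanSpace ℝ (Fin d)) 1)).toReal with hv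
  have hvol : volume (ball (0 : EuclideanSpace ℝ (Fin d)) 1) = ENNReal.ofReal v :=
    (ENNReal.ofReal_toReal measure_ball_lt_top.ne).symm
  have hvpos : 0 < v :=
    ENNReal.toReal_pos (measure_ball_pos volume _ one_pos).ne' measure_ball_lt_top.ne
  have hcb : ∀ (y : EuclideanSpace ℝ (Fin d)) (R : ℝ), 0 ≤ R →
      volume (closedBall y R) = ENNReal.ofReal (R ^ d * v) := by
    intro y R hR
    rw [Measure.addHaar_closedBall _ _ hR, hvol, finrank_euclideanSpace_fin,
      ENNReal.ofReal_mul (by positivity)]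
  have hint : ∫ x, (closedBall (0 : EuclideanSpace ℝ (Fin d)) r).indicator (fun _ => (1:ℝ)) x
      = r ^ d * v := by
    rw [integral_indicator_const _ measurableSet_closedBall, measureReal_def, hcb _ _ hr0.le,
      ENNReal.toReal_ofReal (by positivity)]
    simp
  have hR : 0 < 1 + lam - r := by linarith
  refine ⟨(closedBall 0 r).indicator (fun _ => 1), (Set.Iic r).indicator (fun _ => 1),
    (1 - r) * r ^ d, ?_, ?_, ?_, ?_, ?_, ?_, ?_⟩
  · exact (integrable_indicator_iff measurableSet_closedBall).2
      (integrableOn_const measure_closedBall_lt_top.ne)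
  · intro s _
    exact Set.indicator_nonneg (fun _ _ => zero_le_one) _
  · intro a _ b _ hab
    by_cases hb : b ≤ r
    · have ha : a ≤ r := hab.trans hb
      simp [Set.indicator, ha, hb]
    · rw [Set.indicator_of_notMem (by simpa using hb)]
      exact Set.indicator_nonneg (fun _ _ => zero_le_one) _
  · intro x
    simp [Set.indicator]
  · rw [hint]; positivity
  · have : 0 < 1 - r := by linarith
    positivity
  · rw [hint]
    have h1r : 0 < 1 - r := by linarith
    have hsub : closedBall (0 : EuclideanSpace ℝ (Fin d)) (1 + lam - r) ⊆
        {x | ENNReal.ofReal ((1 - r) * r ^ d) <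
          almostMaximal d lam ((closedBall 0 r).indicator (fun _ => 1)) x} := by
      intro x hx
      rw [mem_closedBall_zero_iff] at hx
      set y : EuclideanSpace ℝ (Fin d) := ((1 - r) / (1 + lam - r)) • x with hy
      have hy1 : ‖y‖ ≤ 1 - r := by
        rw [hy, norm_smul, Real.norm_of_nonneg (by positivity), div_mul_eq_mul_div,
          div_le_iff₀ hR]
        gcongr
      have hy2 : ‖x - y‖ ≤ lam * 1 := by
        have : x - y = (lam / (1 + lam - r)) • x := by
          have e : lam / (1 + lam - r) = 1 - (1 - r) / (1 + lam - r) := by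
            field_simp; ring
          rw [e, sub_smul, one_smul]
        rw [this, norm_smul, Real.norm_of_nonneg (by positivity), div_mul_eq_mul_div,
          div_le_iff₀ hR, mul_one]
        gcongr
      have hss : closedBall (0 : EuclideanSpace ℝ (Fin d)) r ⊆ closedBall y 1 := by
        apply closedBall_subset_closedBall'
        rw [dist_zero_left]; linarith
      show _ < almostMaximal d lam _ x
      have hle : (∫⁻ z in closedBall y 1, ENNReal.ofReal
          ((closedBall (0 : EuclideanSpace ℝ (Fin d)) r).indicator (fun _ => (1:ℝ)) z))
          / volume (closedBall y 1) ≤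
          almostMaximal d lam ((closedBall 0 r).indicator (fun _ => 1)) x := by
        unfold almostMaximal
        exact le_iSup₂_of_le y 1 (le_iSup₂_of_le one_pos hy2 le_rfl)
      refine lt_of_lt_of_le ?_ hle
      have e : (fun z => ENNReal.ofReal
          ((closedBall (0 : EuclideanSpace ℝ (Fin d)) r).indicator (fun _ => (1:ℝ)) z))
          = (closedBall (0 : EuclideanSpace ℝ (Fin d)) r).indicator (fun _ => (1:ℝ≥0∞)) := by
        ext z
        by_cases hz : z ∈ closedBall (0 : EuclideanSpace ℝ (Fin d)) r
        · rw [Set.indicator_of_mem hz, Set.indicator_of_mem hz, ENNReal.ofReal_one]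
        · rw [Set.indicator_of_notMem hz, Set.indicator_of_notMem hz, ENNReal.ofReal_zero]
      rw [e, lintegral_indicator measurableSet_closedBall, setLIntegral_const, one_mul,
        Measure.restrict_apply measurableSet_closedBall, Set.inter_eq_left.2 hss,
        hcb _ _ hr0.le, hcb _ _ zero_le_one, ← ENNReal.ofReal_div_of_pos (by positivity)]
      rw [ENNReal.ofReal_lt_ofReal_iff (by positivity), one_pow, one_mul,
        mul_div_assoc, div_self hvpos.ne', mul_one]
      have : 0 < r ^ d := by positivity
      nlinarith
    refine lt_of_lt_of_le ?_ (measure_mono hsub)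
    rw [hcb _ _ hR.le, ENNReal.ofReal_lt_ofReal_iff (by positivity)]
    have : c / ((1 - r) * r ^ d) * (r ^ d * v) = c / (1 - r) * v := by
      field_simp
    rw [this]
    gcongr
    rw [div_lt_iff₀ h1r]
    linarith
end

section
/- Let d ≥ 1 and let e₁ denote the first standard unit vector of ℝ^d. For all real numbers r ∈ [0,1] and t with 1 − r < t ≤ 1, one has the inclusion B(e₁,r) ∩ B(0,t) ⊆ B( ((1 + t² − r²)/2)·e₁ , r t ), where B(y,ρ) is the closed Euclidean ball of center y and radius ρ. -/
open MeasureTheory Metric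

theorem ball_inter_subset_ball_of_le_one
    (d : ℕ) (hd : 1 ≤ d) (r t : ℝ) (hr : r ∈ Set.Icc (0 : ℝ) 1)
    (ht1 : 1 - r < t) (ht2 : t ≤ 1) :
    closedBall (EuclideanSpace.single (⟨0, hd⟩ : Fin d) (1 : ℝ)) r
        ∩ closedBall (0 : EuclideanSpace ℝ (Fin d)) t
      ⊆ closedBall
          (((1 + t ^ 2 - r ^ 2) / 2) • EuclideanSpace.single (⟨0, hd⟩ : Fin d) (1 : ℝ))
          (r * t) := by
  obtain ⟨hr0, hr1⟩ := hr
  have key : ∀ e : EuclideanSpace ℝ (Fin d), ‖e‖ = 1 →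
      closedBall e r ∩ closedBall (0 : EuclideanSpace ℝ (Fin d)) t
        ⊆ closedBall (((1 + t ^ 2 - r ^ 2) / 2) • e) (r * t) := by
    intro e he x hx
    obtain ⟨h1, h2⟩ := hx
    rw [mem_closedBall, dist_eq_norm] at h1 h2 ⊢
    rw [sub_zero] at h2
    have ht0 : 0 ≤ t := by linarith
    have h1' : ‖x - e‖ ^ 2 ≤ r ^ 2 := pow_le_pow_left₀ (norm_nonneg _) h1 2
    have h2' : ‖x‖ ^ 2 ≤ t ^ 2 := pow_le_pow_left₀ (norm_nonneg _) h2 2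
    apply (pow_le_pow_iff_left₀ (norm_nonneg _) (mul_nonneg hr0 ht0) two_ne_zero).1
    rw [norm_sub_sq_real, he] at h1'
    rw [norm_sub_sq_real, inner_smul_right, norm_smul, he, mul_one, Real.norm_eq_abs, sq_abs]
    generalize inner ℝ x e = a at *
    generalize ‖x‖ ^ 2 = s at *
    have hc0 : 0 ≤ (1 + t ^ 2 - r ^ 2) / 2 := by nlinarith
    have hc1 : 0 ≤ 1 - (1 + t ^ 2 - r ^ 2) / 2 := by nlinarith
    have e1 := mul_le_mul_of_nonneg_left h1' hc0
    have e2 := mul_le_mul_of_nonneg_left h2' hc1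
    nlinarith [sq_nonneg (1 - r ^ 2 - t ^ 2)]
  exact key _ (by simp)
end

section
/- Let d ≥ 1, λ ∈ [0,1], and let g ∈ L¹(ℝ^d) be a nonnegative radial decreasing function (g(x) = h(‖x‖) with h : [0,∞) → [0,∞) nonincreasing). Then for every x ∈ ℝ^d with x ≠ 0, M_λ g(x) ≤ ‖g‖₁ / |B(x/(1+λ), ‖x‖/(1+λ))|; equivalently, M_λ g(x) ≤ (1+λ)^d · ‖g‖₁ / (ω_d ‖x‖^d), where ω_d is the volume of the unit ball in ℝ^d. -/
open MeasureTheory Metric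
open scoped ENNReal

theorem aux_incl {E : Type*} [NormedAddCommGroup E] [InnerProductSpace ℝ E] (y z : E) (s ρ R : ℝ)
    (hs : 0 ≤ s) (hρ : 0 ≤ ρ) (hR : 0 < R) (hsR : s ≤ R) (hy : R ≤ ‖y‖)
    (h1 : ‖z‖ ≤ s) (h2 : ‖z - y‖ ≤ ρ) :
    ‖z - (s ^ 2 / R ^ 2) • y‖ ≤ ρ / R * s := by
  set θ := s ^ 2 / R ^ 2 with hθ
  have hθ0 : 0 ≤ θ := by positivity
  have hθ1 : θ ≤ 1 := by
    rw [hθ, div_le_one (by positivity)]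
    gcongr
  have hsθ : s ^ 2 = θ * R ^ 2 := by
    rw [hθ]; field_simp
  have e1 : ‖z - θ • y‖ ^ 2 = (1 - θ) * ‖z‖ ^ 2 + θ * ‖z - y‖ ^ 2 - θ * (1 - θ) * ‖y‖ ^ 2 := by
    rw [norm_sub_sq_real, norm_sub_sq_real, inner_smul_right, norm_smul, Real.norm_eq_abs, mul_pow,
      sq_abs]
    ring
  have a1 : ‖z‖ ^ 2 ≤ s ^ 2 := by gcongr
  have a2 : ‖z - y‖ ^ 2 ≤ ρ ^ 2 := by gcongr
  have a3 : R ^ 2 ≤ ‖y‖ ^ 2 := by gcongr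
  have b1 := mul_le_mul_of_nonneg_left a1 (sub_nonneg.2 hθ1)
  have b2 := mul_le_mul_of_nonneg_left a2 hθ0
  have b3 := mul_le_mul_of_nonneg_left a3 (mul_nonneg hθ0 (sub_nonneg.2 hθ1))
  have e2 : (ρ / R * s) ^ 2 = θ * ρ ^ 2 := by
    rw [hθ]; field_simp
  apply le_of_sq_le_sq _ (by positivity)
  rw [e2, e1]
  rw [hsθ] at b1
  nlinarith

theorem aux_level (d : ℕ) (hd : 1 ≤ d) (A : Set (EuclideanSpace ℝ (Fin d)))
    (hA : ∀ z ∈ A, ∀ w : EuclideanSpace ℝ (Fin d), ‖w‖ ≤ ‖z‖ → w ∈ A)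
    (y : EuclideanSpace ℝ (Fin d)) (ρ R : ℝ) (hρ : 0 < ρ) (hR : 0 < R) (hy : R ≤ ‖y‖) :
    volume (A ∩ closedBall y ρ) ≤ ENNReal.ofReal ((ρ / R) ^ d) * volume A := by
  haveI : Nonempty (Fin d) := ⟨⟨0, hd⟩⟩
  have key : ∀ (c : EuclideanSpace ℝ (Fin d)) (s : ℝ), 0 ≤ s →
      volume (closedBall c (ρ / R * s)) =
        ENNReal.ofReal ((ρ / R) ^ d) * volume (ball (0 : EuclideanSpace ℝ (Fin d)) s) := by
    intro c s hs
    rw [Measure.addHaar_closedBall _ _ (by positivity), Measure.addHaar_ball _ _ hs,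
      finrank_euclideanSpace_fin, mul_pow, ENNReal.ofReal_mul (by positivity), mul_assoc]
  by_cases hbig : ∃ z ∈ A, R ≤ ‖z‖
  · obtain ⟨z, hz, hzR⟩ := hbig
    have hsub : ball (0 : EuclideanSpace ℝ (Fin d)) R ⊆ A := fun w hw =>
      hA z hz w ((mem_ball_zero_iff.1 hw).le.trans hzR)
    have := key y R hR.le
    rw [div_mul_cancel₀ _ hR.ne'] at this
    calc _ ≤ volume (closedBall y ρ) := measure_mono Set.inter_subset_right
      _ ≤ _ := by rw [this]; gcongr
  · push Not at hbig
    rcases A.eq_empty_or_nonempty with rfl | hne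
    · simp
    have hbdd : BddAbove (norm '' A) := ⟨R, by rintro _ ⟨z, hz, rfl⟩; exact (hbig z hz).le⟩
    have hne' : (norm '' A).Nonempty := hne.image _
    set s := sSup (norm '' A) with hs
    have hle : ∀ z ∈ A, ‖z‖ ≤ s := fun z hz => le_csSup hbdd ⟨z, hz, rfl⟩
    have hs0 : 0 ≤ s := (norm_nonneg _).trans (hle _ hne.some_mem)
    have hsR : s ≤ R := csSup_le hne' (by rintro _ ⟨z, hz, rfl⟩; exact (hbig z hz).le)
    have hsub : ball (0 : EuclideanSpace ℝ (Fin d)) s ⊆ A := by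
      intro w hw
      obtain ⟨_, ⟨z, hz, rfl⟩, hlt⟩ := exists_lt_of_lt_csSup hne' (mem_ball_zero_iff.1 hw)
      exact hA z hz w hlt.le
    calc _ ≤ volume (closedBall ((s ^ 2 / R ^ 2) • y) (ρ / R * s)) := by
          apply measure_mono
          rintro z ⟨hz, hzy⟩
          rw [mem_closedBall, dist_eq_norm] at hzy ⊢
          exact aux_incl y z s ρ R hs0 hρ.le hR hsR hy (hle z hz) hzy
      _ ≤ _ := by rw [key _ _ hs0]; gcongr

theorem almostMaximal_le_of_radial_decreasing
    (d : ℕ) (hd : 1 ≤ d) (lam : ℝ) (hlam : lam ∈ Set.Icc (0 : ℝ) 1)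
    (g : EuclideanSpace ℝ (Fin d) → ℝ) (hg : Integrable g)
    (h : ℝ → ℝ) (hpos : ∀ r : ℝ, 0 ≤ r → 0 ≤ h r)
    (hmono : AntitoneOn h (Set.Ici (0 : ℝ)))
    (hrad : ∀ x : EuclideanSpace ℝ (Fin d), g x = h ‖x‖) :
    ∀ x : EuclideanSpace ℝ (Fin d), x ≠ 0 →
      almostMaximal d lam g x
        ≤ ENNReal.ofReal (∫ z, g z)
            / volume (closedBall ((1 + lam)⁻¹ • x) (‖x‖ / (1 + lam))) := by
  intro x hx
  obtain ⟨hl0, hl1⟩ := hlam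
  have hxn : 0 < ‖x‖ := norm_pos_iff.2 hx
  haveI : Nonempty (Fin d) := ⟨⟨0, hd⟩⟩
  have hg0 : ∀ z, 0 ≤ g z := fun z => by rw [hrad]; exact hpos _ (norm_nonneg _)
  have hint : ENNReal.ofReal (∫ z, g z) = ∫⁻ z, ENNReal.ofReal (g z) :=
    ofReal_integral_eq_lintegral_ofReal hg (Filter.Eventually.of_forall hg0)
  set R := ‖x‖ / (1 + lam) with hRdef
  have hR : 0 < R := by positivity
  have hxR : ‖x‖ = (1 + lam) * R := by rw [hRdef]; field_simp
  unfold almostMaximal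
  refine iSup_le fun y => iSup_le fun ρ => iSup_le fun hρ => iSup_le fun hxy => ?_
  rw [hint]
  rcases le_total R ρ with hRρ | hρR
  · refine ENNReal.div_le_div (setLIntegral_le_lintegral _ _) ?_
    rw [Measure.addHaar_closedBall _ _ hR.le, Measure.addHaar_closedBall _ _ hρ.le]
    gcongr
  have hy : R ≤ ‖y‖ := by
    have h1 : ‖x‖ ≤ ‖x - y‖ + ‖y‖ := by simpa using norm_add_le (x - y) y
    nlinarith [mul_le_mul_of_nonneg_left hρR hl0]
  have hK : ∫⁻ z in closedBall y ρ, ENNReal.ofReal (g z) ≤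
      ENNReal.ofReal ((ρ / R) ^ d) * ∫⁻ z, ENNReal.ofReal (g z) := by
    rw [lintegral_eq_lintegral_meas_lt _ (Filter.Eventually.of_forall hg0) hg.aemeasurable.restrict,
      lintegral_eq_lintegral_meas_lt _ (Filter.Eventually.of_forall hg0) hg.aemeasurable,
      ← lintegral_const_mul' _ _ ENNReal.ofReal_ne_top]
    refine lintegral_mono fun t => ?_
    rw [Measure.restrict_apply' measurableSet_closedBall]
    refine aux_level d hd _ ?_ y ρ R hρ hR hy
    intro z hz w hwz
    simp only [Set.mem_setOf_eq, hrad] at hz ⊢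
    exact hz.trans_le (hmono (norm_nonneg _) (norm_nonneg _) hwz)
  have hv : volume (closedBall y ρ) = ENNReal.ofReal ((ρ / R) ^ d) *
      volume (closedBall ((1 + lam)⁻¹ • x) R) := by
    rw [Measure.addHaar_closedBall _ _ hR.le, Measure.addHaar_closedBall _ _ hρ.le,
      finrank_euclideanSpace_fin, ← mul_assoc, ← ENNReal.ofReal_mul (by positivity), ← mul_pow,
      div_mul_cancel₀ _ hR.ne']
  rw [hv]
  refine (ENNReal.div_le_div_right hK _).trans ?_
  rw [ENNReal.mul_div_mul_left _ _ (by simpa using by positivity) ENNReal.ofReal_ne_top]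
end
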